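/- arXiv:1407.0871 — 2 statements merged into one kernel-verified Lean document; each statement's English description precedes it below -/
import Mathlib

section
/- The Bass stable rank of the Bohl algebra B is infinite. Precisely: for every positive integer n there exists an (n+1)-tuple (f_1, …, f_n, g) of elements of B which is unimodular (there exist x_1, …, x_{n+1} ∈ B with x_1·f_1 + … + x_n·f_n + x_{n+1}·g = 1) but not reducible (there do NOT exist a_1, …, a_n ∈ B such that the n-tuple (f_1 + a_1·g, …, f_n + a_n·g) is unimodular). -/
open Complex

noncomputable section

/-- The Bohl algebra: the subalgebra of functions `ℝ → ℂ` (pointwise operations)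
spanned over `ℂ` by the functions `t ↦ t^k * exp (λ * t)`, `k ∈ ℕ`, `λ ∈ ℂ`. -/
def Bohl : Subalgebra ℂ (ℝ → ℂ) :=
  Algebra.adjoin ℂ
    {g : ℝ → ℂ | ∃ (k : ℕ) (l : ℂ), g = fun t : ℝ => (t : ℂ) ^ k * Complex.exp (l * t)}

namespace BohlStableRank

open Polynomial MeasureTheory Metric Module
open scoped NNReal RealInnerProductSpace

lemma lipschitzWith_indicator_closedBall {V : Type*} [NormedAddCommGroup V] [NormedSpace ℝ V]
    {h : V → V} {K : ℝ≥0} (hK : LipschitzOnWith K h (closedBall 0 1))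
    (h0 : ∀ v, ‖v‖ = 1 → h v = 0) : LipschitzWith K ((closedBall 0 1).indicator h) := by
  have key : ∀ x y : V, ‖x‖ ≤ 1 → 1 < ‖y‖ → ‖h x‖ ≤ K * ‖x - y‖ := by
    intro x y hx hy
    have hc : ContinuousOn (fun t : ℝ => ‖x + t • (y - x)‖) (Set.Icc 0 1) := by fun_prop
    obtain ⟨t, ht, hz⟩ := intermediate_value_Icc zero_le_one hc
      (show (1 : ℝ) ∈ _ from ⟨by simpa using hx, by simpa using hy.le⟩)
    have h1 := hK.dist_le_mul x (by simpa using hx) (x + t • (y - x)) (by simpa using hz.le)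
    rw [h0 _ hz, dist_zero_right, dist_eq_norm] at h1
    refine h1.trans (mul_le_mul_of_nonneg_left ?_ K.2)
    rw [sub_add_cancel_left, norm_neg, norm_smul, norm_sub_rev x y, Real.norm_of_nonneg ht.1]
    exact mul_le_of_le_one_left (norm_nonneg _) ht.2
  refine LipschitzWith.of_dist_le_mul fun x y => ?_
  by_cases hx : ‖x‖ ≤ 1 <;> by_cases hy : ‖y‖ ≤ 1
  · simpa [Set.indicator, hx, hy] using hK.dist_le_mul x (by simpa using hx) y (by simpa using hy)
  · simpa [Set.indicator, hx, hy, dist_eq_norm] using key x y hx (not_le.1 hy)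
  · simpa [Set.indicator, hx, hy, dist_eq_norm, norm_sub_rev x y] using key y x hy (not_le.1 hx)
  · simp only [Set.indicator, mem_closedBall, dist_zero_right, hx, hy, if_false, dist_self]
    positivity

lemma bijective_add_of_lipschitzWith {V : Type*} [NormedAddCommGroup V] [NormedSpace ℝ V]
    [CompleteSpace V] {H : V → V} {c : ℝ≥0} (hH : LipschitzWith c H) (hc : c < 1) :
    Function.Bijective fun v => v + H v := by
  have ha : ApproximatesLinearOn (fun v => v + H v)
      ((ContinuousLinearEquiv.refl ℝ V : V ≃L[ℝ] V) : V →L[ℝ] V) Set.univ c := by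
    intro x _ y _
    simpa [add_sub_add_comm, dist_eq_norm] using hH.dist_le_mul x y
  have hN : Subsingleton V ∨ c < ‖((ContinuousLinearEquiv.refl ℝ V).symm : V →L[ℝ] V)‖₊⁻¹ := by
    rcases subsingleton_or_nontrivial V with hV | hV
    · exact Or.inl hV
    · right
      have : ‖((ContinuousLinearEquiv.refl ℝ V).symm : V →L[ℝ] V)‖₊ = 1 := by
        ext; simp
      simpa [this] using hc
  exact ⟨Set.injOn_univ.1 (ha.injOn hN), ha.surjective hN⟩

lemma image_closedBall_add {V : Type*} [NormedAddCommGroup V] [NormedSpace ℝ V]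
    {H : V → V} (hb : Function.Bijective fun v => v + H v) (h0 : ∀ v, 1 < ‖v‖ → H v = 0) :
    (fun v => v + H v) '' closedBall 0 1 = closedBall 0 1 := by
  have h1 : (fun v => v + H v) '' (closedBall 0 1)ᶜ = (closedBall 0 1)ᶜ := by
    refine (Set.image_congr fun v hv => ?_).trans (Set.image_id _)
    simp [h0 v (by simpa using hv)]
  rw [Set.image_compl_eq hb] at h1
  exact compl_injective h1

lemma exists_polynomial_integral {α : Type*} [MeasurableSpace α] (μ : Measure α)
    (q : α → ℝ[X]) (D : ℕ) (hD : ∀ a, (q a).natDegree ≤ D)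
    (hi : ∀ t : ℝ, Integrable (fun a => (q a).eval t) μ) :
    ∃ P : ℝ[X], ∀ t : ℝ, P.eval t = ∫ a, (q a).eval t ∂μ := by
  have hinj : Set.InjOn (fun i : ℕ => (i : ℝ)) (Finset.range (D + 1)) :=
    fun a _ b _ hab => Nat.cast_injective hab
  refine ⟨Lagrange.interpolate (Finset.range (D + 1)) (fun i : ℕ => (i : ℝ))
    fun i => ∫ a, (q a).eval (i : ℝ) ∂μ, fun t => ?_⟩
  have h1 : ∀ a, (q a).eval t = ∑ i ∈ Finset.range (D + 1), (q a).eval (i : ℝ) *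
      (Lagrange.basis (Finset.range (D + 1)) (fun i : ℕ => (i : ℝ)) i).eval t := by
    intro a
    have h2 := Lagrange.eq_interpolate (f := q a) hinj (by
      rw [Finset.card_range]
      exact (degree_le_of_natDegree_le (hD a)).trans_lt (by exact_mod_cast Nat.lt_succ_self D))
    conv_lhs => rw [h2]
    simp [Lagrange.interpolate_apply, eval_finsetSum]
  rw [integral_congr_ae (Filter.Eventually.of_forall h1),
    integral_finsetSum _ fun (i : ℕ) _ => (hi i).mul_const _]
  simp [Lagrange.interpolate_apply, eval_finsetSum, integral_mul_const]

lemma eval_det_X_smul_add {n : Type*} [Fintype n] [DecidableEq n] (M : Matrix n n ℝ) (t : ℝ) :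
    ((X : ℝ[X]) • M.map C + (1 : Matrix n n ℝ).map C).det.eval t = (1 + t • M).det := by
  rw [← coe_evalRingHom, RingHom.map_det]
  congr 1
  ext i j
  by_cases hij : i = j <;> simp [hij, mul_comm t, add_comm]

lemma exists_polynomial_det {V : Type*} [AddCommGroup V] [Module ℝ V] [FiniteDimensional ℝ V]
    (A : V →ₗ[ℝ] V) :
    ∃ p : ℝ[X], p.natDegree ≤ finrank ℝ V ∧
      ∀ t : ℝ, p.eval t = LinearMap.det (LinearMap.id + t • A) := by
  classical
  have b := Free.chooseBasis ℝ V
  rw [finrank_eq_card_basis b]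
  refine ⟨_, natDegree_det_X_add_C_le (LinearMap.toMatrix b b A) 1, fun t => ?_⟩
  rw [← LinearMap.det_toMatrix b, map_add, map_smul, LinearMap.toMatrix_id, eval_det_X_smul_add]

lemma exists_polynomial_pow_mul_det {V : Type*} [NormedAddCommGroup V] [InnerProductSpace ℝ V]
    [FiniteDimensional ℝ V] (r : ℝ) (m : ℕ) (v w : V) (A : V →L[ℝ] V) :
    ∃ p : ℝ[X], p.natDegree ≤ m * 2 + finrank ℝ V ∧ ∀ t : ℝ, p.eval t =
      (r - ‖v + t • w‖ ^ 2) ^ m * (ContinuousLinearMap.id ℝ V + t • A).det := by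
  obtain ⟨p, hp, hpt⟩ := exists_polynomial_det (A : V →ₗ[ℝ] V)
  refine ⟨(C (r - ‖v‖ ^ 2) - C (2 * ⟪v, w⟫) * X - C (‖w‖ ^ 2) * X ^ 2) ^ m * p, ?_, fun t => ?_⟩
  · refine natDegree_mul_le.trans (add_le_add (natDegree_pow_le.trans ?_) hp)
    refine Nat.mul_le_mul_left _ ?_
    compute_degree
  · rw [eval_mul, hpt, norm_add_sq_real, inner_smul_right, norm_smul, mul_pow, Real.norm_eq_abs,
      sq_abs]
    congr 1
    simp only [eval_pow, eval_sub, eval_mul, eval_C, eval_X]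
    ring

section Degree

variable {V : Type*} [NormedAddCommGroup V] [InnerProductSpace ℝ V] [FiniteDimensional ℝ V]
  [MeasurableSpace V] [BorelSpace V]

/-- Both sides are values of a polynomial in `t` attached to the maps `v ↦ v + t • h v`; by the
change of variables formula it is constant for small `t`, where these maps permute the ball. -/
lemma integral_pow_mul_det {h : V → V} (hC : ∀ v ∈ closedBall (0 : V) 1, ContDiffAt ℝ 1 h v)
    (h0 : ∀ v, ‖v‖ = 1 → h v = 0) (r : ℝ) (m : ℕ) :
    ∫ v in closedBall (0 : V) 1, (r - ‖v + h v‖ ^ 2) ^ m *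
        (ContinuousLinearMap.id ℝ V + fderiv ℝ h v).det =
      ∫ v in closedBall (0 : V) 1, (r - ‖v‖ ^ 2) ^ m := by
  have hcomp : IsCompact (closedBall (0 : V) 1) := isCompact_closedBall 0 1
  have hc : ContinuousOn h (closedBall 0 1) := fun v hv => (hC v hv).continuousAt.continuousWithinAt
  have hc' : ContinuousOn (fderiv ℝ h) (closedBall 0 1) := fun v hv =>
    ((hC v hv).fderiv_right (m := 0) (by simp)).continuousAt.continuousWithinAt
  obtain ⟨K, hK⟩ := hcomp.exists_bound_of_continuousOn hc'
  have hlip : LipschitzOnWith K.toNNReal h (closedBall 0 1) :=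
    (convex_closedBall 0 1).lipschitzOnWith_of_nnnorm_fderiv_le
      (fun v hv => (hC v hv).differentiableAt one_ne_zero)
      (fun v hv => NNReal.coe_le_coe.1 ((hK v hv).trans (Real.le_coe_toNNReal K)))
  have hLip := lipschitzWith_indicator_closedBall hlip h0
  choose q hqD hq using fun v : V => exists_polynomial_pow_mul_det r m v (h v) (fderiv ℝ h v)
  obtain ⟨P, hP⟩ := exists_polynomial_integral (volume.restrict (closedBall (0 : V) 1)) q _ hqD
    fun t => by
      simp only [hq]
      refine ContinuousOn.integrableOn_compact hcomp (ContinuousOn.mul (by fun_prop) ?_)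
      exact ContinuousLinearMap.continuous_det.comp_continuousOn (by fun_prop)
  simp only [hq] at hP
  obtain ⟨ε, hε, hdet⟩ : ∃ ε > 0, ∀ A : V →L[ℝ] V, ‖A‖ < ε →
      0 < (ContinuousLinearMap.id ℝ V + A).det := by
    have h1 : Filter.Tendsto (fun A : V →L[ℝ] V => (ContinuousLinearMap.id ℝ V + A).det)
        (nhds 0) (nhds 1) := by
      have : Continuous fun A : V →L[ℝ] V => (ContinuousLinearMap.id ℝ V + A).det :=
        ContinuousLinearMap.continuous_det.comp (by fun_prop)
      simpa [ContinuousLinearMap.det] using this.tendsto 0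
    obtain ⟨ε, hε, h2⟩ := Metric.eventually_nhds_iff.1 (h1.eventually (lt_mem_nhds zero_lt_one))
    exact ⟨ε, hε, fun A hA => h2 (by simpa using hA)⟩
  obtain ⟨δ, hδ, hδ'⟩ : ∃ δ > 0, ∀ t ∈ Set.Ioo 0 δ, t * |K| < 1 ∧ t * |K| < ε := by
    refine ⟨min 1 ε / (|K| + 1), by positivity, fun t ht => lt_min_iff.1 ?_⟩
    have h1 := (lt_div_iff₀ (by positivity)).1 ht.2
    linarith [ht.1]
  have hKabs : K ≤ |K| := le_abs_self K
  have hsmall : ∀ t ∈ Set.Ioo 0 δ,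
      P.eval t = ∫ v in closedBall (0 : V) 1, (r - ‖v‖ ^ 2) ^ m := by
    intro t ht
    have hbij : Function.Bijective
        fun v => v + (t • (closedBall (0 : V) 1).indicator h) v := by
      refine bijective_add_of_lipschitzWith (c := t.toNNReal * K.toNNReal) ?_ ?_
      · refine LipschitzWith.of_dist_le_mul fun x y => ?_
        rw [Pi.smul_apply, Pi.smul_apply, dist_smul₀, NNReal.coe_mul, mul_assoc,
          Real.norm_of_nonneg ht.1.le, Real.coe_toNNReal t ht.1.le]
        exact mul_le_mul_of_nonneg_left (hLip.dist_le_mul x y) ht.1.le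
      · rw [← NNReal.coe_lt_coe, NNReal.coe_mul, Real.coe_toNNReal t ht.1.le, Real.coe_toNNReal']
        exact (mul_le_mul_of_nonneg_left (max_le hKabs (abs_nonneg K)) ht.1.le).trans_lt
          (hδ' t ht).1
    have himg := image_closedBall_add hbij fun v hv => by simp [hv]
    have heq : Set.EqOn (fun v => v + (t • (closedBall (0 : V) 1).indicator h) v)
        (fun v => v + t • h v) (closedBall 0 1) := by
      intro v hv
      simp only [Pi.smul_apply, Set.indicator_of_mem hv]
    have hinj := heq.injOn_iff.1 hbij.injective.injOn
    rw [heq.image_eq] at himg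
    have hcv := integral_image_eq_integral_abs_det_fderiv_smul volume
      (measurableSet_closedBall (x := (0 : V)) (ε := 1))
      (f := fun v => v + t • h v) (f' := fun v => ContinuousLinearMap.id ℝ V + t • fderiv ℝ h v)
      (fun v hv => ((hasFDerivAt_id v).add
        (((hC v hv).differentiableAt one_ne_zero).hasFDerivAt.const_smul t)).hasFDerivWithinAt)
      hinj (fun v => (r - ‖v‖ ^ 2) ^ m)
    rw [himg] at hcv
    rw [hP, hcv]
    refine setIntegral_congr_fun measurableSet_closedBall fun v hv => ?_
    have hpos := hdet (t • fderiv ℝ h v) (by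
      rw [norm_smul, Real.norm_of_nonneg ht.1.le]
      exact (mul_le_mul_of_nonneg_left ((hK v hv).trans hKabs) ht.1.le).trans_lt (hδ' t ht).2)
    simp only [abs_of_pos hpos, smul_eq_mul, mul_comm]
  have hconst : P = C (∫ v in closedBall (0 : V) 1, (r - ‖v‖ ^ 2) ^ m) := by
    refine eq_of_infinite_eval_eq _ _ ((Set.Ioo_infinite hδ).mono fun t ht => ?_)
    simp [hsmall t ht]
  have h1 := hP 1
  rw [hconst] at h1
  simpa using h1.symm

/-- A form of Brouwer's theorem: a `C¹` perturbation of the identity of the closed unit ball which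
fixes the unit sphere has a zero. -/
theorem exists_add_eq_zero {h : V → V} (hC : ∀ v ∈ closedBall (0 : V) 1, ContDiffAt ℝ 1 h v)
    (h0 : ∀ v, ‖v‖ = 1 → h v = 0) : ∃ v ∈ closedBall (0 : V) 1, v + h v = 0 := by
  by_contra! hne
  have hcomp : IsCompact (closedBall (0 : V) 1) := isCompact_closedBall 0 1
  have hc : ContinuousOn h (closedBall 0 1) := fun v hv => (hC v hv).continuousAt.continuousWithinAt
  have hc' : ContinuousOn (fderiv ℝ h) (closedBall 0 1) := fun v hv =>
    ((hC v hv).fderiv_right (m := 0) (by simp)).continuousAt.continuousWithinAt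
  have hn : ContinuousOn (fun v => ‖v + h v‖) (closedBall 0 1) := by fun_prop
  obtain ⟨v₀, hv₀, hmin⟩ := hcomp.exists_isMinOn ⟨0, by simp⟩ hn
  obtain ⟨M, hM⟩ := hcomp.exists_bound_of_continuousOn hn
  have hdc : ContinuousOn (fun v => (ContinuousLinearMap.id ℝ V + fderiv ℝ h v).det)
      (closedBall 0 1) := ContinuousLinearMap.continuous_det.comp_continuousOn (by fun_prop)
  obtain ⟨D, hD⟩ := hcomp.exists_bound_of_continuousOn hdc
  obtain ⟨c, hc0, hc1, hcle⟩ : ∃ c > 0, c ≤ 1 ∧ ∀ v ∈ closedBall (0 : V) 1, c ≤ ‖v + h v‖ :=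
    ⟨min 1 ‖v₀ + h v₀‖, lt_min one_pos (norm_pos_iff.2 (hne v₀ hv₀)), min_le_left _ _,
      fun v hv => (min_le_right _ _).trans (hmin hv)⟩
  obtain ⟨r, hr1, hrM⟩ : ∃ r : ℝ, 1 < r ∧ M ^ 2 ≤ r :=
    ⟨2 + M ^ 2, by nlinarith [sq_nonneg M], by linarith⟩
  have hc2 : c ^ 2 ≤ 1 := pow_le_one₀ hc0.le hc1
  set B := closedBall (0 : V) 1
  set B' := closedBall (0 : V) (c / 2)
  have hB' : B' ⊆ B := closedBall_subset_closedBall (by linarith)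
  have hlow : ∀ m : ℕ, (r - c ^ 2 / 4) ^ m * volume.real B' ≤ ∫ v in B, (r - ‖v‖ ^ 2) ^ m := by
    intro m
    have hint : IntegrableOn (fun v : V => (r - ‖v‖ ^ 2) ^ m) B :=
      ContinuousOn.integrableOn_compact hcomp (by fun_prop)
    calc (r - c ^ 2 / 4) ^ m * volume.real B' = ∫ v in B', (r - c ^ 2 / 4) ^ m := by
          simp [mul_comm]
      _ ≤ ∫ v in B', (r - ‖v‖ ^ 2) ^ m := by
          refine setIntegral_mono_on (integrableOn_const measure_closedBall_lt_top.ne)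
            (hint.mono_set hB')
            measurableSet_closedBall fun v hv => ?_
          have hv' : ‖v‖ ≤ c / 2 := by simpa [B'] using hv
          refine pow_le_pow_left₀ (by linarith) ?_ m
          nlinarith [norm_nonneg v]
      _ ≤ ∫ v in B, (r - ‖v‖ ^ 2) ^ m := by
          refine setIntegral_mono_set hint ?_ hB'.eventuallyLE
          refine (ae_restrict_iff' measurableSet_closedBall).2 (.of_forall fun v hv => ?_)
          have hv' : ‖v‖ ≤ 1 := by simpa [B] using hv
          exact pow_nonneg (by nlinarith [norm_nonneg v]) m
  have hup : ∀ m : ℕ, ∫ v in B, (r - ‖v‖ ^ 2) ^ m ≤ (r - c ^ 2) ^ m * (D * volume.real B) := by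
    intro m
    rw [← integral_pow_mul_det hC h0 r m, ← mul_assoc]
    refine (Real.le_norm_self _).trans
      (norm_setIntegral_le_of_norm_le_const measure_closedBall_lt_top fun v hv => ?_)
    have h1 : ‖v + h v‖ ≤ M := by simpa using hM v hv
    have h2 := hcle v hv
    rw [norm_mul, norm_pow]
    refine mul_le_mul (pow_le_pow_left₀ (norm_nonneg _) ?_ m) (hD v hv) (norm_nonneg _)
      (pow_nonneg (by linarith) m)
    rw [Real.norm_of_nonneg (by nlinarith [norm_nonneg (v + h v)])]
    nlinarith
  have hvol : 0 < volume.real B' :=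
    ENNReal.toReal_pos (measure_closedBall_pos _ _ (by positivity)).ne' measure_closedBall_lt_top.ne
  have hs : 0 < r - c ^ 2 / 4 := by linarith
  have hlim := (tendsto_pow_atTop_nhds_zero_of_lt_one (r := (r - c ^ 2) / (r - c ^ 2 / 4))
    (div_nonneg (by linarith) hs.le)
    ((div_lt_one hs).2 (by nlinarith [sq_pos_of_pos hc0]))).mul_const (D * volume.real B)
  rw [zero_mul] at hlim
  refine hvol.not_ge (ge_of_tendsto' hlim fun m => ?_)
  rw [div_pow, div_mul_eq_mul_div, le_div_iff₀ (pow_pos hs m), mul_comm]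
  exact (hlow m).trans (hup m)

end Degree

lemma eq_zero_of_forall_eval_ofReal {p : ℂ[X]} (h : ∀ t : ℝ, p.eval (t : ℂ) = 0) : p = 0 :=
  eq_zero_of_infinite_isRoot p <|
    (Set.infinite_range_of_injective Complex.ofReal_injective).mono (by rintro _ ⟨t, rfl⟩; exact h t)

lemma eq_zero_of_derivative_add_C_mul {p : ℂ[X]} {c : ℂ} (hc : c ≠ 0)
    (h : derivative p + C c * p = 0) : p = 0 := by
  by_contra hp
  have h1 : degree (C c * p) = degree p := degree_C_mul hc
  have h2 : degree (derivative p) = degree p := by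
    rw [eq_neg_of_add_eq_zero_left h, degree_neg, h1]
  exact (degree_derivative_lt hp).ne h2

lemma hasDerivAt_eval_mul_exp (p : ℂ[X]) (c : ℂ) (t : ℝ) :
    HasDerivAt (fun t : ℝ => p.eval (t : ℂ) * exp (c * t))
      ((derivative p + C c * p).eval (t : ℂ) * exp (c * t)) t := by
  have h1 : HasDerivAt (fun z : ℂ => p.eval z * exp (c * z))
      ((derivative p).eval (t : ℂ) * exp (c * t) + p.eval (t : ℂ) * (exp (c * t) * (c * 1))) t :=
    (p.hasDerivAt _).mul (((hasDerivAt_id _).const_mul c).cexp)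
  convert h1.comp_ofReal using 1
  simp only [eval_add, eval_mul, eval_C]
  ring

/-- Exponential polynomials with distinct exponents are linearly independent. -/
lemma eq_zero_of_sum_eval_mul_exp (s : Finset ℂ) : ∀ p : ℂ → ℂ[X],
    (∀ t : ℝ, ∑ l ∈ s, (p l).eval (t : ℂ) * exp (l * t) = 0) → ∀ l ∈ s, p l = 0 := by
  induction s using Finset.induction_on with
  | empty => simp
  | insert a s ha ih =>
    suffices H : ∀ (d : ℕ) (p : ℂ → ℂ[X]), derivative^[d] (p a) = 0 →
        (∀ t : ℝ, ∑ l ∈ insert a s, (p l).eval (t : ℂ) * exp (l * t) = 0) →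
        ∀ l ∈ insert a s, p l = 0 from
      fun p hp => H _ p (iterate_derivative_eq_zero (Nat.lt_succ_self (p a).natDegree)) hp
    intro d
    induction d with
    | zero =>
      intro p hpa hp
      rw [Function.iterate_zero, id] at hpa
      simp only [Finset.sum_insert ha, hpa, eval_zero, zero_mul, zero_add] at hp
      simpa [hpa] using ih p hp
    | succ d ihd =>
      intro p hpa hp
      have hp' : ∀ t : ℝ, ∑ l ∈ insert a s, (p l).eval (t : ℂ) * exp ((l - a) * t) = 0 := by
        intro t
        rw [← zero_mul (exp (-a * t)), ← hp t, Finset.sum_mul]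
        refine Finset.sum_congr rfl fun l _ => ?_
        rw [mul_assoc, ← exp_add]
        ring_nf
      have hq := ihd (fun l => derivative (p l) + C (l - a) * p l) (by simpa using hpa) fun t => by
        have h1 : HasDerivAt (fun t : ℝ => ∑ l ∈ insert a s, (p l).eval (t : ℂ) *
            exp ((l - a) * t)) _ t :=
          HasDerivAt.fun_sum fun l _ => hasDerivAt_eval_mul_exp (p l) (l - a) t
        simp only [hp'] at h1
        have h2 := h1.unique (hasDerivAt_const t 0)
        rw [← zero_mul (exp (a * t)), ← h2, Finset.sum_mul]
        refine Finset.sum_congr rfl fun l _ => ?_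
        rw [mul_assoc, ← exp_add]
        ring_nf
      have hs : ∀ l ∈ s, p l = 0 := fun l hl =>
        eq_zero_of_derivative_add_C_mul (sub_ne_zero.2 (ne_of_mem_of_not_mem hl ha))
          (hq l (Finset.mem_insert_of_mem hl))
      have hpa0 : p a = 0 := eq_zero_of_forall_eval_ofReal fun t => by
        have h1 := hp t
        rw [Finset.sum_insert ha, Finset.sum_eq_zero fun l hl => by rw [hs l hl]; simp] at h1
        simpa using h1
      simpa [hpa0] using hs

/-- The function `t ↦ ∑ p l (t) * exp (l * t)` attached to a formal sum of exponentials with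
polynomial coefficients. -/
def toFunction : AddMonoidAlgebra ℂ[X] ℂ →+* (ℝ → ℂ) :=
  AddMonoidAlgebra.liftNCRingHom (RingHom.pi fun t : ℝ => evalRingHom (t : ℂ))
    { toFun := fun l t => exp (l.toAdd * t)
      map_one' := by ext; simp
      map_mul' := fun a b => by ext t; simp [add_mul, exp_add] }
    fun _ _ => Commute.all _ _

lemma toFunction_single (l : ℂ) (p : ℂ[X]) (t : ℝ) :
    toFunction (.single l p) t = p.eval (t : ℂ) * exp (l * t) := by
  simp [toFunction]

lemma toFunction_injective : Function.Injective toFunction := by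
  refine (injective_iff_map_eq_zero _).2 fun x hx => ?_
  have h1 := eq_zero_of_sum_eval_mul_exp x.coeff.support x.coeff fun t => by
    simp_rw [← toFunction_single, ← Finset.sum_apply, ← map_sum]
    have h2 := congr_fun hx t
    rwa [← AddMonoidAlgebra.sum_coeff_single x] at h2
  ext1
  exact Finsupp.ext fun l => by_contra fun hl => hl (h1 l (Finsupp.mem_support_iff.2 hl))

lemma toFunction_mem_Bohl (x : AddMonoidAlgebra ℂ[X] ℂ) : toFunction x ∈ Bohl := by
  induction x using AddMonoidAlgebra.induction_linear with
  | zero => simp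
  | add x y hx hy => simpa using Bohl.add_mem hx hy
  | single l p =>
    induction p using Polynomial.induction_on' with
    | add p q hp hq => simpa using Bohl.add_mem hp hq
    | monomial k c =>
      have h1 : toFunction (.single l (monomial k c)) =
          c • fun t : ℝ => (t : ℂ) ^ k * exp (l * t) := by
        ext t
        simp [toFunction_single, mul_assoc]
      rw [h1]
      exact Bohl.smul_mem (Algebra.subset_adjoin ⟨k, l, rfl⟩) c

lemma exists_toFunction_eq {f : ℝ → ℂ} (hf : f ∈ Bohl) : ∃ x, toFunction x = f := by
  induction hf using Algebra.adjoin_induction with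
  | mem f hf =>
    obtain ⟨k, l, rfl⟩ := hf
    exact ⟨.single l (X ^ k), by ext t; simp [toFunction_single]⟩
  | algebraMap c => exact ⟨.single 0 (C c), by ext t; simp [toFunction_single]⟩
  | add f g _ _ hf hg =>
    obtain ⟨⟨x, rfl⟩, y, rfl⟩ := And.intro hf hg
    exact ⟨x + y, map_add _ _ _⟩
  | mul f g _ _ hf hg =>
    obtain ⟨⟨x, rfl⟩, y, rfl⟩ := And.intro hf hg
    exact ⟨x * y, map_mul _ _ _⟩

variable {ι : Type*} [Fintype ι]

/-- The ring homomorphism sending `t` to `0` and `exp (l * t)` to `exp (∑ i, L i l * w i)`. -/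
def specialization (L : ι → ℂ →+ ℝ) (w : ι → ℝ) : AddMonoidAlgebra ℂ[X] ℂ →+* ℂ :=
  AddMonoidAlgebra.liftNCRingHom (evalRingHom 0)
    { toFun := fun l => exp ((∑ i, L i l.toAdd * w i : ℝ) : ℂ)
      map_one' := by simp
      map_mul' := fun a b => by simp [add_mul, exp_add, Finset.sum_add_distrib] }
    fun _ _ => Commute.all _ _

lemma specialization_single (L : ι → ℂ →+ ℝ) (w : ι → ℝ) (l : ℂ) (p : ℂ[X]) :
    specialization L w (.single l p) = p.eval 0 * exp ((∑ i, L i l * w i : ℝ) : ℂ) := by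
  simp [specialization]

lemma contDiff_specialization (L : ι → ℂ →+ ℝ) (x : AddMonoidAlgebra ℂ[X] ℂ) :
    ContDiff ℝ 1 fun w => specialization L w x := by
  induction x using AddMonoidAlgebra.induction_linear with
  | zero => simpa using contDiff_const
  | add x y hx hy => simpa using hx.add hy
  | single l p =>
    simp only [specialization_single]
    have h : ContDiff ℝ 1 fun w : ι → ℝ => ∑ i, L i l * w i := by fun_prop
    exact contDiff_const.mul (Complex.contDiff_exp.comp (Complex.ofRealCLM.contDiff.comp h))

lemma exists_dual_family (ι : Type*) [Fintype ι] [DecidableEq ι] :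
    ∃ (l : ι → ℂ) (L : ι → ℂ →+ ℝ), ∀ i j, L i (l j) = if i = j then 1 else 0 := by
  let b := Basis.ofVectorSpace ℚ ℂ
  have hinf : Infinite (Basis.ofVectorSpaceIndex ℚ ℂ) := by
    refine Cardinal.infinite_iff.2 ?_
    rw [b.mk_eq_rank'', Complex.rank_rat_complex]
    exact Cardinal.aleph0_le_continuum
  obtain ⟨e⟩ : Nonempty (ι ↪ Basis.ofVectorSpaceIndex ℚ ℂ) :=
    ⟨(Fintype.equivFin ι).toEmbedding.trans
      (Fin.valEmbedding.trans (Infinite.natEmbedding _))⟩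
  refine ⟨fun i => b (e i), fun i => (Rat.castHom ℝ).toAddMonoidHom.comp
    (b.coord (e i)).toAddMonoidHom, fun i j => ?_⟩
  by_cases hij : i = j <;> simp [hij]

/-- The complex form of `exists_add_eq_zero`, for a perturbation `(1 - ‖v‖²) • a v` of the identity
of `ℂⁿ = ℝ²ⁿ`. -/
lemma exists_complex_add_eq_zero {n : ℕ} {a : EuclideanSpace ℝ (Fin n × Bool) → Fin n → ℂ}
    (ha : ∀ v ∈ closedBall (0 : EuclideanSpace ℝ (Fin n × Bool)) 1,
      ∀ j, ContDiffAt ℝ 1 (fun v => a v j) v) :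
    ∃ v ∈ closedBall (0 : EuclideanSpace ℝ (Fin n × Bool)) 1, ∀ j,
      (v (j, false) + I * v (j, true) : ℂ) + a v j * ((1 - ‖v‖ ^ 2 : ℝ) : ℂ) = 0 := by
  let h (v : EuclideanSpace ℝ (Fin n × Bool)) : EuclideanSpace ℝ (Fin n × Bool) :=
    WithLp.toLp 2 fun k => (if k.2 then (a v k.1).im else (a v k.1).re) * (1 - ‖v‖ ^ 2)
  have hC : ∀ v ∈ closedBall (0 : EuclideanSpace ℝ (Fin n × Bool)) 1, ContDiffAt ℝ 1 h v := by
    refine fun v hv => contDiffAt_euclidean.2 fun k => ?_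
    have hn : ContDiffAt ℝ 1 (fun v : EuclideanSpace ℝ (Fin n × Bool) => 1 - ‖v‖ ^ 2) v :=
      contDiffAt_const.sub (contDiff_norm_sq ℝ).contDiffAt
    refine ContDiffAt.mul ?_ hn
    rcases k with ⟨j, _ | _⟩
    · exact Complex.reCLM.contDiff.contDiffAt.comp v (ha v hv j)
    · exact Complex.imCLM.contDiff.contDiffAt.comp v (ha v hv j)
  have h0 : ∀ v, ‖v‖ = 1 → h v = 0 := by
    intro v hv
    ext k
    simp [h, hv]
  obtain ⟨v, hv, hv0⟩ := exists_add_eq_zero hC h0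
  refine ⟨v, hv, fun j => ?_⟩
  have hre := congr_arg (fun u : EuclideanSpace ℝ (Fin n × Bool) => u (j, false)) hv0
  have him := congr_arg (fun u : EuclideanSpace ℝ (Fin n × Bool) => u (j, true)) hv0
  apply Complex.ext
  · simpa [h, -ofReal_sub] using hre
  · simpa [h, -ofReal_sub] using him

end BohlStableRank

open BohlStableRank Polynomial Metric in
/-- The Bass stable rank of the Bohl algebra is infinite: for every `n ≥ 1` there is a
unimodular `(n+1)`-tuple in `B` that is not reducible. -/
theorem bsr_Bohl_infinite (n : ℕ) (hn : 0 < n) :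
    ∃ (f : Fin n → ℝ → ℂ) (g : ℝ → ℂ),
      (∀ j, f j ∈ Bohl) ∧ g ∈ Bohl ∧
      (∃ (x : Fin n → ℝ → ℂ) (y : ℝ → ℂ),
        (∀ j, x j ∈ Bohl) ∧ y ∈ Bohl ∧ (∑ j, x j * f j) + y * g = 1) ∧
      ¬ ∃ a : Fin n → ℝ → ℂ, (∀ j, a j ∈ Bohl) ∧
          ∃ x : Fin n → ℝ → ℂ, (∀ j, x j ∈ Bohl) ∧
            (∑ j, x j * (f j + a j * g)) = 1 := by
  obtain ⟨l, L, hL⟩ := exists_dual_family (Fin n × Bool)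
  let u (k : Fin n × Bool) : AddMonoidAlgebra ℂ[X] ℂ := .single (l k) 1 - 2
  let J : AddMonoidAlgebra ℂ[X] ℂ := .single 0 (C I)
  have hJ : J * J = -1 := by
    simp only [J, AddMonoidAlgebra.single_mul_single, ← C_mul, I_mul_I]
    simp [AddMonoidAlgebra.one_def]
  let F (j : Fin n) := u (j, false) + J * u (j, true)
  let G := 1 - ∑ k, u k ^ 2
  refine ⟨fun j => toFunction (F j), toFunction G, fun j => toFunction_mem_Bohl _,
    toFunction_mem_Bohl _, ⟨fun j => toFunction (u (j, false) - J * u (j, true)), 1,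
      fun j => toFunction_mem_Bohl _, Bohl.one_mem, ?_⟩, ?_⟩
  · rw [← map_one toFunction]
    simp only [← map_mul, ← map_sum, ← map_add]
    congr 1
    have h1 : ∀ j, (u (j, false) - J * u (j, true)) * F j =
        u (j, true) ^ 2 + u (j, false) ^ 2 := fun j => by
      linear_combination -u (j, true) ^ 2 * hJ
    simp [G, h1, Fintype.sum_prod_type]
  · rintro ⟨a, ha, x, hx, hax⟩
    choose α hα using fun j => exists_toFunction_eq (ha j)
    choose ξ hξ using fun j => exists_toFunction_eq (hx j)
    simp only [← hα, ← hξ, ← map_mul, ← map_sum, ← map_add, ← map_one toFunction] at hax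
    replace hax := toFunction_injective hax
    let w (v : EuclideanSpace ℝ (Fin n × Bool)) (k : Fin n × Bool) : ℝ := Real.log (2 + v k)
    have hpos : ∀ v ∈ closedBall (0 : EuclideanSpace ℝ (Fin n × Bool)) 1, ∀ k, 0 < 2 + v k := by
      intro v hv k
      have h1 := (PiLp.norm_apply_le v k).trans (mem_closedBall_zero_iff.1 hv)
      linarith [(abs_le.1 h1).1]
    obtain ⟨v, hv, hv0⟩ := exists_complex_add_eq_zero (a := fun v j => specialization L (w v) (α j))
      fun v hv j => (contDiff_specialization L (α j)).contDiffAt.comp v <|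
        contDiffAt_pi.2 fun k => ContDiffAt.log (by fun_prop) (hpos v hv k).ne'
    have hu : ∀ k, specialization L (w v) (u k) = v k := by
      intro k
      have h1 : ∑ i, L i (l k) * w v i = Real.log (2 + v k) := by simp [hL, w]
      simp only [u, map_sub, map_ofNat, specialization_single, h1, Real.exp_log (hpos v hv k),
        ← ofReal_exp]
      simp
    have hG : specialization L (w v) G = ((1 - ‖v‖ ^ 2 : ℝ) : ℂ) := by
      simp [G, hu, EuclideanSpace.norm_sq_eq]
    have hJ' : specialization L (w v) J = I := by simp [J, specialization_single]
    have h1 := congr_arg (specialization L (w v)) hax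
    simp only [map_sum, map_mul, map_add, F, hu, hG, hJ', hv0, mul_zero, Finset.sum_const_zero,
      map_one] at h1
    exact zero_ne_one h1
end
end

section
/- The ring E of all entire functions of the form z ↦ Σ_{j=1}^n c_j·z^{n_j}·exp(λ_j·z), with c_j, λ_j ∈ ℂ and n_j ∈ ℕ, has infinite Bass stable rank: for every positive integer n there exists an (n+1)-tuple of elements of E that is unimodular in E but not reducible in E. -/
open Complex

noncomputable section

/-- The ring `E` of entire functions of the form `z ↦ ∑ cⱼ z^{nⱼ} e^{λⱼ z}`: the
subalgebra of functions `ℂ → ℂ` (pointwise operations) spanned over `ℂ` by the functions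
`z ↦ z^k * exp (λ * z)`, `k ∈ ℕ`, `λ ∈ ℂ`. -/
def EBohl : Subalgebra ℂ (ℂ → ℂ) :=
  Algebra.adjoin ℂ
    {g : ℂ → ℂ | ∃ (k : ℕ) (l : ℂ), g = fun z : ℂ => z ^ k * Complex.exp (l * z)}

open Polynomial in
theorem LinearMap.exists_polynomial_eval_eq_det {V : Type*} [AddCommGroup V] [Module ℝ V]
    [FiniteDimensional ℝ V] (A : V →ₗ[ℝ] V) :
    ∃ p : ℝ[X], p.natDegree ≤ Module.finrank ℝ V ∧
      ∀ t : ℝ, p.eval t = LinearMap.det (LinearMap.id + t • A) := by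
  let b := Module.finBasis ℝ V
  let M := LinearMap.toMatrix b b A
  refine ⟨Matrix.det ((X : ℝ[X]) • M.map C + (1 : Matrix _ _ ℝ).map C), ?_, fun t => ?_⟩
  · simpa using Polynomial.natDegree_det_X_add_C_le M 1
  · rw [← LinearMap.det_toMatrix b, ← Polynomial.coe_evalRingHom, RingHom.map_det]
    congr 1
    ext i j
    rcases eq_or_ne i j with rfl | hij
    · simp [M]
      ring
    · simp [M, hij]
      ring

theorem LinearMap.det_eq_sum_lagrange {V : Type*} [AddCommGroup V] [Module ℝ V]
    [FiniteDimensional ℝ V] (A : V →ₗ[ℝ] V) {v : ℕ → ℝ} (hv : Function.Injective v) (t : ℝ) :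
    LinearMap.det (LinearMap.id + t • A) =
      ∑ j ∈ Finset.range (Module.finrank ℝ V + 1),
        LinearMap.det (LinearMap.id + v j • A) *
          (Lagrange.basis (Finset.range (Module.finrank ℝ V + 1)) v j).eval t := by
  obtain ⟨p, hp, hpt⟩ := A.exists_polynomial_eval_eq_det
  have h := Lagrange.eq_interpolate (f := p) (s := Finset.range (Module.finrank ℝ V + 1)) (v := v)
    hv.injOn (by
      rw [Finset.card_range]
      exact lt_of_le_of_lt p.degree_le_natDegree (by exact_mod_cast Nat.lt_succ_of_le hp))
  rw [← hpt, h, Lagrange.interpolate_apply, Polynomial.eval_finsetSum]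
  refine Finset.sum_congr rfl fun j _ => ?_
  rw [Polynomial.eval_mul, Polynomial.eval_C, hpt]

open MeasureTheory Metric Set in
/-- A `C¹` self-map of a Euclidean space fixing the unit sphere pointwise has a zero: otherwise its
normalization would be a `C¹` retraction of the ball onto the sphere. -/
theorem exists_eq_zero_of_eq_self_on_unit_sphere {V : Type*} [NormedAddCommGroup V]
    [InnerProductSpace ℝ V] [FiniteDimensional ℝ V] {F : V → V} (hF : ContDiff ℝ 1 F)
    (hS : ∀ x, ‖x‖ = 1 → F x = x) : ∃ x, F x = 0 := by
  rcases subsingleton_or_nontrivial V with hV | hV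
  · exact ⟨0, Subsingleton.elim _ _⟩
  by_contra! h0
  borelize V
  set h : V → V := fun x => ‖F x‖⁻¹ • F x - x with hh
  have hr : ContDiff ℝ 1 fun x => ‖F x‖⁻¹ • F x :=
    ((hF.norm ℝ h0).inv fun x => norm_ne_zero_iff.2 (h0 x)).smul hF
  have hC : ContDiff ℝ 1 h := hr.sub contDiff_id
  have hS' : ∀ x, ‖x‖ = 1 → h x = 0 := fun x hx => by simp [hh, hS x hx, hx]
  have hD : Continuous (fderiv ℝ h) := hC.continuous_fderiv one_ne_zero
  have hd : ∀ x, HasFDerivAt h (fderiv ℝ h x) x := fun x =>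
    (hC.differentiable one_ne_zero x).hasFDerivAt
  set B : Set V := closedBall 0 1 with hB
  have hBc : IsCompact B := isCompact_closedBall _ _
  -- the derivative of the retraction is singular
  have hdet : ∀ x, LinearMap.det (LinearMap.id + (1 : ℝ) • (fderiv ℝ h x : V →ₗ[ℝ] V)) = 0 := by
    intro x
    by_contra hne
    have hu : HasFDerivAt (fun x => ‖F x‖⁻¹ • F x)
        (ContinuousLinearMap.id ℝ V + fderiv ℝ h x) x := by
      have := (hasFDerivAt_id (𝕜 := ℝ) x).add (hd x)
      refine this.congr_of_eventuallyEq
        (Filter.Eventually.of_forall fun y => ?_)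
      simp [hh]
    have hsq := hu.norm_sq
    have hconst : (fun x => ‖‖F x‖⁻¹ • F x‖ ^ 2) = fun _ => (1 : ℝ) := by
      funext y
      rw [norm_smul, norm_inv, norm_norm, inv_mul_cancel₀ (norm_ne_zero_iff.2 (h0 y)), one_pow]
    rw [hconst] at hsq
    have hz := hsq.unique (hasFDerivAt_const (1 : ℝ) x)
    have hsurj := (LinearEquiv.ofIsUnitDet (v := Module.finBasis ℝ V) (v' := Module.finBasis ℝ V)
      (f := LinearMap.id + (1 : ℝ) • (fderiv ℝ h x : V →ₗ[ℝ] V))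
      (by rw [LinearMap.det_toMatrix]; exact isUnit_iff_ne_zero.2 hne)).surjective
    obtain ⟨w, hw⟩ := hsurj (‖F x‖⁻¹ • F x)
    have hw' : w + fderiv ℝ h x w = ‖F x‖⁻¹ • F x := by simpa using hw
    have := DFunLike.congr_fun hz w
    simp only [smul_apply, ContinuousLinearMap.comp_apply,
      add_apply, ContinuousLinearMap.id_apply, hw', innerSL_apply_apply] at this
    simp [h0 x] at this
  obtain ⟨K, hK⟩ : ∃ K : NNReal, ∀ x ∈ B, ‖fderiv ℝ h x‖₊ ≤ K := by
    obtain ⟨C, hC⟩ := hBc.exists_bound_of_continuousOn hD.continuousOn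
    exact ⟨C.toNNReal, fun x hx => by
      rw [← NNReal.coe_le_coe]; exact (hC x hx).trans (Real.le_coe_toNNReal C)⟩
  have hLip : LipschitzOnWith K h B :=
    (convex_closedBall 0 1).lipschitzOnWith_of_nnnorm_fderiv_le
      (fun x _ => (hd x).differentiableAt) hK
  set g : V → V := B.indicator h with hg
  have hgin : ∀ x ∈ B, g x = h x := fun x hx => indicator_of_mem hx h
  have hgout : ∀ x ∉ B, g x = 0 := fun x hx => indicator_of_notMem hx h
  have hmix : ∀ x ∈ B, ∀ y ∉ B, dist (g x) (g y) ≤ K * dist x y := by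
    intro x hx y hy
    obtain ⟨z, hz, hz1⟩ : ∃ z ∈ segment ℝ x y, ‖z‖ = 1 := by
      have := (convex_segment x y).isPreconnected.intermediate_value
        (left_mem_segment ℝ x y) (right_mem_segment ℝ x y) (continuous_norm.continuousOn)
      simp only [hB, mem_closedBall, dist_zero_right, not_le] at hx hy
      obtain ⟨z, hz, h1⟩ := this ⟨hx, hy.le⟩
      exact ⟨z, hz, h1⟩
    have hzB : z ∈ B := by simp [hB, hz1]
    have h1 := hLip.dist_le_mul x hx z hzB
    have h2 := dist_add_dist_of_mem_segment hz
    rw [hgin x hx, hgout y hy, ← hS' z hz1]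
    refine h1.trans ?_
    gcongr
    linarith [dist_nonneg (x := z) (y := y)]
  have hgL : LipschitzWith K g := by
    refine LipschitzWith.of_dist_le_mul fun x y => ?_
    by_cases hx : x ∈ B <;> by_cases hy : y ∈ B
    · rw [hgin x hx, hgin y hy]; exact hLip.dist_le_mul x hx y hy
    · exact hmix x hx y hy
    · rw [dist_comm, dist_comm x]; exact hmix y hy x hx
    · rw [hgout x hx, hgout y hy, dist_self]; positivity
  obtain ⟨δ, hδ, hpos⟩ : ∃ δ > 0, ∀ A : V →L[ℝ] V, ‖A‖ < δ →
      0 < (ContinuousLinearMap.id ℝ V + A).det := by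
    have hc : ContinuousAt (fun A : V →L[ℝ] V => (ContinuousLinearMap.id ℝ V + A).det) 0 :=
      (ContinuousLinearMap.continuous_det.comp (continuous_const.add continuous_id)).continuousAt
    have : ∀ᶠ A in nhds (0 : V →L[ℝ] V), 0 < (ContinuousLinearMap.id ℝ V + A).det :=
      hc.eventually (lt_mem_nhds (by simp [ContinuousLinearMap.det]))
    obtain ⟨δ, hδ, H⟩ := Metric.eventually_nhds_iff.1 this
    exact ⟨δ, hδ, fun A hA => H (by simpa using hA)⟩
  have key : ∀ t : ℝ, 0 < t → t * K < 1 → t * K < δ →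
      ∫ x in B, LinearMap.det (LinearMap.id + t • (fderiv ℝ h x : V →ₗ[ℝ] V)) =
        volume.real B := by
    intro t ht ht1 htδ
    have happ : ApproximatesLinearOn (fun x => x + t • g x)
        ((ContinuousLinearEquiv.refl ℝ V : V ≃L[ℝ] V) : V →L[ℝ] V) univ (t.toNNReal * K) := by
      rw [ApproximatesLinearOn.approximatesLinearOn_iff_lipschitzOnWith, lipschitzOnWith_univ]
      refine LipschitzWith.of_dist_le_mul fun x y => ?_
      have := hgL.dist_le_mul x y
      simp only [Pi.sub_apply, ContinuousLinearEquiv.coe_coe, ContinuousLinearEquiv.coe_refl',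
        id_eq, add_sub_cancel_left, dist_smul₀, NNReal.coe_mul, Real.coe_toNNReal t ht.le,
        Real.norm_of_nonneg ht.le, mul_assoc]
      gcongr
    have hc : Subsingleton V ∨ t.toNNReal * K <
        ‖((ContinuousLinearEquiv.refl ℝ V).symm : V →L[ℝ] V)‖₊⁻¹ := by
      right
      have : ‖((ContinuousLinearEquiv.refl ℝ V).symm : V →L[ℝ] V)‖₊ = 1 := by
        simp
      rw [this, inv_one, ← NNReal.coe_lt_coe]
      simpa [Real.coe_toNNReal t ht.le] using ht1
    have hinj := injOn_univ.1 (happ.injOn hc)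
    have hsurj := happ.surjective hc
    have himg : (fun x => x + t • h x) '' B = B := by
      have : (fun x => x + t • h x) '' B = (fun x => x + t • g x) '' B :=
        image_congr fun x hx => by rw [hgin x hx]
      rw [this]
      apply Subset.antisymm
      · rintro _ ⟨x, hx, rfl⟩
        by_contra hn
        have := hinj (show (fun x => x + t • g x) (x + t • g x) = (fun x => x + t • g x) x by
          simp [hgout _ hn])
        exact hn (show x + t • g x ∈ B by rw [show x + t • g x = x from this]; exact hx)
      · intro y hy
        obtain ⟨x, rfl⟩ := hsurj y
        refine ⟨x, ?_, rfl⟩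
        by_contra hn
        simp only [hgout x hn, smul_zero, add_zero] at hy
        exact hn hy
    have hcv := integral_image_eq_integral_abs_det_fderiv_smul (volume : Measure V)
      (s := B) (f := fun x => x + t • h x)
      (f' := fun x => ContinuousLinearMap.id ℝ V + t • fderiv ℝ h x)
      hBc.measurableSet
      (fun x _ => ((hasFDerivAt_id x).add ((hd x).const_smul t)).hasFDerivWithinAt)
      (fun x hx y hy hxy => hinj (by simpa only [hgin x hx, hgin y hy] using hxy))
      (fun _ => (1 : ℝ))
    rw [himg] at hcv
    simp only [integral_const, measureReal_restrict_apply_univ, smul_eq_mul, mul_one] at hcv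
    rw [hcv]
    refine setIntegral_congr_fun hBc.measurableSet fun x hx => ?_
    have hp := hpos (t • fderiv ℝ h x) (by
      rw [norm_smul, Real.norm_of_nonneg ht.le]
      refine lt_of_le_of_lt ?_ htδ
      gcongr
      exact hK x hx)
    rw [abs_of_pos hp]
    simp [ContinuousLinearMap.det]
  obtain ⟨c, hc0, hc1⟩ : ∃ c > 0, c * (K : ℝ) < min 1 δ :=
    exists_pos_mul_lt (lt_min one_pos hδ) K |>.imp fun c hc => ⟨hc.1, by rw [mul_comm]; exact hc.2⟩
  set v : ℕ → ℝ := fun j => c / (j + 1) with hv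
  have hvi : Function.Injective v := by
    intro i j hij
    have hi : (i : ℝ) + 1 ≠ 0 := by positivity
    have hj : (j : ℝ) + 1 ≠ 0 := by positivity
    simp only [hv] at hij
    rw [div_eq_div_iff hi hj] at hij
    have := mul_left_cancel₀ hc0.ne' hij
    exact_mod_cast (add_right_cancel this).symm
  have hvk : ∀ j, 0 < v j ∧ v j * K < min 1 δ := fun j => by
    refine ⟨by positivity, lt_of_le_of_lt ?_ hc1⟩
    gcongr
    exact div_le_self hc0.le (by linarith [(Nat.cast_nonneg j : (0 : ℝ) ≤ j)])
  have hdetInt : ∀ t : ℝ, IntegrableOn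
      (fun x => LinearMap.det (LinearMap.id + t • (fderiv ℝ h x : V →ₗ[ℝ] V))) B volume := by
    intro t
    have : Continuous fun x => (ContinuousLinearMap.id ℝ V + t • fderiv ℝ h x).det :=
      ContinuousLinearMap.continuous_det.comp (continuous_const.add (hD.const_smul t))
    exact this.continuousOn.integrableOn_compact hBc
  set s := Finset.range (Module.finrank ℝ V + 1) with hs
  have hvol : volume.real B = 0 := by
    calc volume.real B = ∑ j ∈ s, volume.real B * (Lagrange.basis s v j).eval 1 := by
          rw [← Finset.mul_sum, ← Polynomial.eval_finsetSum, Lagrange.sum_basis hvi.injOn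
            (by simp [hs])]
          simp
      _ = ∑ j ∈ s, ∫ x in B, LinearMap.det (LinearMap.id + v j • (fderiv ℝ h x : V →ₗ[ℝ] V)) *
            (Lagrange.basis s v j).eval 1 := by
          refine Finset.sum_congr rfl fun j _ => ?_
          rw [integral_mul_const, key (v j) (hvk j).1 ((hvk j).2.trans_le (min_le_left _ _))
            ((hvk j).2.trans_le (min_le_right _ _))]
      _ = ∫ x in B, LinearMap.det (LinearMap.id + (1 : ℝ) • (fderiv ℝ h x : V →ₗ[ℝ] V)) := by
          rw [← integral_finsetSum _ fun j _ => (hdetInt (v j)).mul_const _]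
          simp_rw [LinearMap.det_eq_sum_lagrange _ hvi 1]
          rfl
      _ = 0 := by simp only [hdet, integral_zero]
  have hpv : 0 < volume.real B :=
    ENNReal.toReal_pos (measure_closedBall_pos volume 0 one_pos).ne' hBc.measure_lt_top.ne
  exact hpv.ne' hvol

/-- The function `z ↦ z ^ k * exp (l * z)`. -/
def monomialExp (k : ℕ) (l : ℂ) : ℂ → ℂ := fun z => z ^ k * Complex.exp (l * z)

theorem linearIndependent_monomialExp_fixed (l : ℂ) :
    LinearIndependent ℂ fun k : ℕ => monomialExp k l := by
  let T : Polynomial ℂ →ₗ[ℂ] (ℂ → ℂ) :=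
    { toFun := fun p z => p.eval z * Complex.exp (l * z)
      map_add' := fun p q => by funext z; simp [add_mul]
      map_smul' := fun c p => by funext z; simp [mul_assoc] }
  have hT : LinearMap.ker T = ⊥ := by
    refine LinearMap.ker_eq_bot'.2 fun p hp => Polynomial.funext fun z => ?_
    have : p.eval z * Complex.exp (l * z) = 0 := congrFun hp z
    simpa [Complex.exp_ne_zero] using this
  have h := (Polynomial.basisMonomials ℂ).linearIndependent.map' T hT
  convert! h using 2 with k
  funext z
  simp [T, monomialExp]

theorem linearIndependent_monomialExp :
    LinearIndependent ℂ fun kl : ℕ × ℂ => monomialExp kl.1 kl.2 := by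
  let S : Submodule ℂ (ℂ → ℂ) :=
    { carrier := {f | Differentiable ℂ f}
      add_mem' := fun hf hg => hf.add hg
      zero_mem' := differentiable_const 0
      smul_mem' := fun c f hf => hf.const_smul c }
  let D : Module.End ℂ S :=
    { toFun := fun f => ⟨deriv f.1, fun z => (f.2.contDiff (n := 2)).differentiable_deriv_two z⟩
      map_add' := fun f g => by
        ext z; exact deriv_add (f.2 z) (g.2 z)
      map_smul' := fun c f => by
        ext z; exact deriv_const_smul c (f.2 z) }
  have hdiff : ∀ k l, Differentiable ℂ (monomialExp k l) := fun k l => by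
    unfold monomialExp; fun_prop
  let e : ℂ → ℕ → S := fun l k => ⟨monomialExp k l, hdiff k l⟩
  have hD : ∀ l k, (D - l • (1 : Module.End ℂ S)) (e l k) = (k : ℂ) • e l (k - 1) := by
    intro l k
    ext z
    have h1 : HasDerivAt (monomialExp k l)
        (k * z ^ (k - 1) * Complex.exp (l * z) + z ^ k * (Complex.exp (l * z) * l)) z := by
      have := (hasDerivAt_pow k z).mul (((hasDerivAt_id z).const_mul l).cexp)
      refine (this.congr_deriv (by simp)).congr_of_eventuallyEq
        (Filter.Eventually.of_forall fun y => ?_)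
      simp [monomialExp]
    change deriv (monomialExp k l) z - l * monomialExp k l z = k * monomialExp (k - 1) l z
    rw [h1.deriv]
    simp only [monomialExp]
    ring
  have hmem : ∀ l k, e l k ∈ D.maxGenEigenspace l := by
    intro l k
    rw [Module.End.mem_maxGenEigenspace]
    refine ⟨k + 1, ?_⟩
    induction k with
    | zero => simp [hD l 0]
    | succ k ih =>
      rw [pow_succ, Module.End.mul_apply, hD, map_smul, Nat.add_sub_cancel, ih, smul_zero]
  have hind : iSupIndep fun l => Submodule.span ℂ (Set.range (e l)) :=
    D.independent_maxGenEigenspace.mono fun l => Submodule.span_le.2 <| by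
      rintro _ ⟨k, rfl⟩
      exact hmem l k
  have hsig : LinearIndependent ℂ fun lk : (Σ _ : ℂ, ℕ) => e lk.1 lk.2 := by
    refine linearIndependent_iUnion_finite
      (fun l => LinearIndependent.of_comp S.subtype (linearIndependent_monomialExp_fixed l))
      fun l t _ hl => ?_
    exact hind.disjoint_biSup hl
  have h2 := hsig.map' S.subtype S.ker_subtype
  exact h2.comp (fun kl : ℕ × ℂ => (⟨kl.2, kl.1⟩ : Σ _ : ℂ, ℕ)) fun a b hab => by
    simp only [Sigma.mk.injEq, heq_eq_eq] at hab
    exact Prod.ext hab.2 hab.1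

theorem exp_mem_EBohl (l : ℂ) : (fun z => Complex.exp (l * z)) ∈ EBohl :=
  Algebra.subset_adjoin ⟨0, l, by simp⟩

/-- An additive character `ℓ` with smooth values induces an algebra homomorphism on `EBohl`
sending `z` to `0` and `exp (l * z)` to `exp (ℓ l)`. -/
theorem exists_algHom_EBohl {V : Type*} [NormedAddCommGroup V] [NormedSpace ℝ V]
    (L : ℂ →+ (V → ℂ)) (hL : ∀ l, ContDiff ℝ 1 (L l)) :
    ∃ Ψ : EBohl →ₐ[ℂ] (V → ℂ), (∀ p, ContDiff ℝ 1 (Ψ p)) ∧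
      ∀ l, Ψ ⟨_, exp_mem_EBohl l⟩ = fun w => Complex.exp (L l w) := by
  let φ : Multiplicative (ℕ × ℂ) →* (ℂ → ℂ) :=
    { toFun := fun kl => monomialExp kl.toAdd.1 kl.toAdd.2
      map_one' := by funext z; simp [monomialExp]
      map_mul' := fun a b => by
        funext z; simp only [monomialExp, toAdd_mul, Prod.fst_add, Prod.snd_add, Pi.mul_apply,
          pow_add, add_mul, Complex.exp_add]; ring }
  let θ : Multiplicative (ℕ × ℂ) →* (V → ℂ) :=
    { toFun := fun kl w => 0 ^ kl.toAdd.1 * Complex.exp (L kl.toAdd.2 w)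
      map_one' := by funext w; simp
      map_mul' := fun a b => by
        funext w; simp only [toAdd_mul, Prod.fst_add, Prod.snd_add, Pi.mul_apply, map_add,
          Pi.add_apply, pow_add, Complex.exp_add]; ring }
  let Φ := AddMonoidAlgebra.lift ℂ (ℂ → ℂ) (ℕ × ℂ) φ
  let Θ := AddMonoidAlgebra.lift ℂ (V → ℂ) (ℕ × ℂ) θ
  have hinj : Function.Injective Φ := by
    refine (injective_iff_map_eq_zero Φ).2 fun p hp => ?_
    have := linearIndependent_iff.1 linearIndependent_monomialExp p.coeff
      (by rw [← hp, AddMonoidAlgebra.lift_apply]; rfl)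
    ext x
    simp [this]
  have hrange : EBohl ≤ Φ.range := by
    refine Algebra.adjoin_le ?_
    rintro _ ⟨k, l, rfl⟩
    exact ⟨AddMonoidAlgebra.single (k, l) 1, by simp [Φ, φ]; rfl⟩
  let Ψ := (Θ.comp ((AlgEquiv.ofInjective Φ hinj).symm : Φ.range →ₐ[ℂ] _)).comp
    (Subalgebra.inclusion hrange)
  refine ⟨Ψ, fun p => ?_, fun l => ?_⟩
  · change ContDiff ℝ 1 (Θ _)
    rw [AddMonoidAlgebra.lift_apply]
    refine Finset.sum_induction _ (ContDiff ℝ 1) (fun _ _ => ContDiff.add) contDiff_const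
      fun a _ => ?_
    have := hL a.2
    exact contDiff_const.smul (contDiff_const.mul this.cexp)
  · have : (AlgEquiv.ofInjective Φ hinj).symm (Subalgebra.inclusion hrange ⟨_, exp_mem_EBohl l⟩) =
        AddMonoidAlgebra.single (0, l) 1 := by
      rw [AlgEquiv.symm_apply_eq]
      ext z
      simp [Φ, φ, monomialExp]
    change Θ ((AlgEquiv.ofInjective Φ hinj).symm
      (Subalgebra.inclusion hrange ⟨_, exp_mem_EBohl l⟩)) = _
    rw [this]
    funext w
    simp [Θ, θ]

/-- There is an algebra homomorphism from `EBohl` to functions on `V` with `C¹` values taking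
prescribed `C¹` real functions as values. -/
theorem exists_algHom_EBohl_apply_eq {V ι : Type*} [NormedAddCommGroup V] [NormedSpace ℝ V]
    [Finite ι] (u : ι → V → ℝ) (hu : ∀ i, ContDiff ℝ 1 (u i)) :
    ∃ (Ψ : EBohl →ₐ[ℂ] (V → ℂ)) (s : ι → EBohl), (∀ p, ContDiff ℝ 1 (Ψ p)) ∧
      ∀ i w, Ψ (s i) w = u i w := by
  let b := Module.Free.chooseBasis ℚ ℂ
  have : Infinite (Module.Free.ChooseBasisIndex ℚ ℂ) := by
    rw [Cardinal.infinite_iff, ← Module.Free.rank_eq_card_chooseBasisIndex,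
      Complex.rank_rat_complex]
    exact Cardinal.aleph0_le_continuum
  obtain ⟨k, ⟨ek⟩⟩ := Finite.exists_equiv_fin ι
  let β : ι → Module.Free.ChooseBasisIndex ℚ ℂ :=
    fun i => Infinite.natEmbedding (Module.Free.ChooseBasisIndex ℚ ℂ) (ek i)
  have hβ : Function.Injective β :=
    (Infinite.natEmbedding _).injective.comp (Fin.val_injective.comp ek.injective)
  let c : Module.Free.ChooseBasisIndex ℚ ℂ → V → ℂ :=
    Function.extend β (fun i w => (Real.arsinh (u i w) : ℂ)) 0
  have hc : ∀ j, ContDiff ℝ 1 (c j) := by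
    intro j
    by_cases hj : ∃ i, β i = j
    · obtain ⟨i, rfl⟩ := hj
      simp only [c, hβ.extend_apply]
      exact Complex.ofRealCLM.contDiff.comp (hu i).arsinh
    · simp only [c, Function.extend_apply' _ _ _ hj]
      exact contDiff_const
  let L : ℂ →ₗ[ℚ] (V → ℂ) := b.constr ℚ c
  obtain ⟨Ψ, hΨ, hexp⟩ := exists_algHom_EBohl L.toAddMonoidHom fun l => by
    change ContDiff ℝ 1 (b.constr ℚ c l)
    rw [Module.Basis.constr_apply]
    exact Finset.sum_induction _ (ContDiff ℝ 1) (fun _ _ => ContDiff.add) contDiff_const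
      fun j _ => by
        simp only [Pi.smul_def, Rat.smul_def]
        exact contDiff_const.mul (hc j)
  refine ⟨Ψ, fun i => (1 / 2 : ℂ) • (⟨_, exp_mem_EBohl (b (β i))⟩ -
    ⟨_, exp_mem_EBohl (-b (β i))⟩), hΨ, fun i w => ?_⟩
  have hLi : L (b (β i)) w = (Real.arsinh (u i w) : ℂ) := by
    simp only [L, Module.Basis.constr_basis, c, hβ.extend_apply]
  rw [map_smul, map_sub, hexp, hexp]
  simp only [Pi.smul_apply, Pi.sub_apply, LinearMap.toAddMonoidHom_coe, map_neg, Pi.neg_apply, hLi]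
  rw [← Real.sinh_arsinh (u i w), Real.arsinh_sinh, Complex.ofReal_sinh, Complex.sinh, smul_eq_mul]
  ring

/-- The ring `E` has infinite Bass stable rank: for every `n ≥ 1` there is a unimodular
`(n+1)`-tuple in `E` that is not reducible. -/
theorem bsr_EBohl_infinite (n : ℕ) (hn : 0 < n) :
    ∃ (f : Fin n → ℂ → ℂ) (g : ℂ → ℂ),
      (∀ j, f j ∈ EBohl) ∧ g ∈ EBohl ∧
      (∃ (x : Fin n → ℂ → ℂ) (y : ℂ → ℂ),
        (∀ j, x j ∈ EBohl) ∧ y ∈ EBohl ∧ (∑ j, x j * f j) + y * g = 1) ∧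
      ¬ ∃ a : Fin n → ℂ → ℂ, (∀ j, a j ∈ EBohl) ∧
          ∃ x : Fin n → ℂ → ℂ, (∀ j, x j ∈ EBohl) ∧
            (∑ j, x j * (f j + a j * g)) = 1 := by
  let V := EuclideanSpace ℂ (Fin n)
  obtain ⟨Ψ, s, hΨ, hs⟩ := exists_algHom_EBohl_apply_eq (V := V) (ι := Fin n ⊕ Fin n)
    (Sum.elim (fun j w => (w j).re) (fun j w => (w j).im)) (by
      have hp : ∀ j : Fin n, ContDiff ℝ 1 fun w : V => w j := fun j =>
        ((EuclideanSpace.proj j : V →L[ℂ] ℂ).restrictScalars ℝ).contDiff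
      rintro (j | j)
      · exact Complex.reCLM.contDiff.comp (hp j)
      · exact Complex.imCLM.contDiff.comp (hp j))
  let f : Fin n → EBohl := fun j => s (.inl j) + Complex.I • s (.inr j)
  let f' : Fin n → EBohl := fun j => s (.inl j) - Complex.I • s (.inr j)
  let g : EBohl := 1 - ∑ j, f' j * f j
  have hf : ∀ j w, Ψ (f j) w = w j := fun j w => by
    simp only [f, map_add, map_smul, Pi.add_apply, Pi.smul_apply, hs, Sum.elim_inl, Sum.elim_inr,
      smul_eq_mul]
    rw [mul_comm, Complex.re_add_im]
  have hf' : ∀ j w, Ψ (f' j) w = (starRingEnd ℂ) (w j) := fun j w => by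
    simp only [f', map_sub, map_smul, Pi.sub_apply, Pi.smul_apply, hs, Sum.elim_inl, Sum.elim_inr,
      smul_eq_mul]
    apply Complex.ext <;> simp
  have hg : ∀ w : V, Ψ g w = 1 - (‖w‖ : ℂ) ^ 2 := fun w => by
    have h2 : (‖w‖ : ℂ) ^ 2 = ∑ j, (‖w j‖ : ℂ) ^ 2 := by
      exact_mod_cast congrArg (fun r : ℝ => (r : ℂ)) (EuclideanSpace.norm_sq_eq w)
    simp only [g, map_sub, map_one, map_sum, map_mul, Pi.sub_apply, Pi.one_apply,
      Finset.sum_apply, Pi.mul_apply, hf, hf', h2, Complex.conj_mul']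
  refine ⟨fun j => f j, g, fun j => (f j).2, g.2,
    ⟨fun j => f' j, 1, fun j => (f' j).2, one_mem _, ?_⟩, ?_⟩
  · have : ∑ j, f' j * f j + 1 * g = 1 := by simp [g]
    simpa using congrArg (Subtype.val) this
  · rintro ⟨a, ha, x, hx, hax⟩
    have hE : ∑ j, (⟨x j, hx j⟩ : EBohl) * (f j + ⟨a j, ha j⟩ * g) = 1 := by
      apply Subtype.ext
      simpa using hax
    let F : V → V := fun w => WithLp.toLp 2 fun j => Ψ (f j + ⟨a j, ha j⟩ * g) w
    have hF : ContDiff ℝ 1 F :=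
      (contDiff_piLp 2).2 fun j => hΨ _
    obtain ⟨w, hw⟩ := exists_eq_zero_of_eq_self_on_unit_sphere hF fun w hw => by
      ext j
      simp [F, hf, hg, hw]
    have h1 := congrFun (congrArg Ψ hE) w
    have hj : ∀ j, Ψ (f j + ⟨a j, ha j⟩ * g) w = 0 := fun j => by
      simpa [F] using congrArg (fun v : V => v j) hw
    rw [map_sum, Finset.sum_apply] at h1
    simp only [map_mul Ψ, Pi.mul_apply, hj, mul_zero, Finset.sum_const_zero, map_one,
      Pi.one_apply] at h1
    exact zero_ne_one h1
end
end
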